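/- Let G be a finitely generated group and R a subgroup of finite index in G. Then R is finitely generated and ω(R) ≤ ω(G)^{2[G:R]−1}. -/

import Mathlib

section GrowthDefs

variable {G : Type*} [Group G]

/-- The ball of radius `n` w.r.t. a finite set `X`: all elements of `G` that are products
of at most `n` letters from `X ∪ X⁻¹`. -/
def wordBall (X : Finset G) (n : ℕ) : Set G :=
  {g | ∃ l : List G, l.length ≤ n ∧ (∀ x ∈ l, x ∈ X ∨ x⁻¹ ∈ X) ∧ l.prod = g}

/-- The growth function `γ_G^X(n) = card {g ∈ G : ‖g‖_X ≤ n}`. -/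
noncomputable def growthFn (X : Finset G) (n : ℕ) : ℕ :=
  Nat.card (wordBall X n)

/-- The exponential growth rate `ω(G,X) = lim_{n→∞} γ_G^X(n)^{1/n}`, which by
submultiplicativity of the growth function equals `inf_{n ≥ 1} γ_G^X(n)^{1/n}`. -/
noncomputable def growthRateX (X : Finset G) : ℝ :=
  ⨅ n : ℕ, (growthFn X (n + 1) : ℝ) ^ ((1 : ℝ) / (n + 1))

/-- The minimal exponential growth rate `ω(G) = inf_X ω(G,X)`, the infimum being taken
over all finite generating sets `X` of `G`. -/
noncomputable def minGrowthRate (G : Type*) [Group G] : ℝ :=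
  sInf {r : ℝ | ∃ X : Finset G, Subgroup.closure (X : Set G) = ⊤ ∧ r = growthRateX X}

/-- `G` has exponential growth: `ω(G,X) > 1` for some (equivalently, every) finite
generating set `X`. -/
def HasExponentialGrowth (G : Type*) [Group G] : Prop :=
  ∃ X : Finset G, Subgroup.closure (X : Set G) = ⊤ ∧ 1 < growthRateX X

end GrowthDefs

section GrowthLemmas

open scoped Pointwise

variable {G : Type*} [Group G]

theorem one_mem_wordBall (X : Finset G) (n : ℕ) : (1 : G) ∈ wordBall X n :=
  ⟨[], by simp, by simp, rfl⟩

theorem wordBall_mono (X : Finset G) {m n : ℕ} (h : m ≤ n) : wordBall X m ⊆ wordBall X n := by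
  rintro g ⟨l, hl, hX, rfl⟩
  exact ⟨l, hl.trans h, hX, rfl⟩

theorem mul_mem_wordBall {X : Finset G} {m n : ℕ} {g h : G} (hg : g ∈ wordBall X m)
    (hh : h ∈ wordBall X n) : g * h ∈ wordBall X (m + n) := by
  obtain ⟨l, hl, hX, rfl⟩ := hg
  obtain ⟨l', hl', hX', rfl⟩ := hh
  refine ⟨l ++ l', by simp; omega, fun x hx => ?_, by simp⟩
  rcases List.mem_append.1 hx with hx | hx
  exacts [hX x hx, hX' x hx]

theorem inv_mem_wordBall {X : Finset G} {n : ℕ} {g : G} (hg : g ∈ wordBall X n) :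
    g⁻¹ ∈ wordBall X n := by
  obtain ⟨l, hl, hX, rfl⟩ := hg
  refine ⟨(l.map (·⁻¹)).reverse, by simpa using hl, fun x hx => ?_, l.prod_inv_reverse.symm⟩
  simp only [List.mem_reverse, List.mem_map] at hx
  obtain ⟨y, hy, rfl⟩ := hx
  simpa using (hX y hy).symm

theorem letter_mem_wordBall_one {X : Finset G} {x : G} (hx : x ∈ X ∨ x⁻¹ ∈ X) :
    x ∈ wordBall X 1 :=
  ⟨[x], by simp, by simpa using hx, by simp⟩

theorem wordBall_add_subset (X : Finset G) (m n : ℕ) :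
    wordBall X (m + n) ⊆ wordBall X m * wordBall X n := by
  rintro g ⟨l, hl, hX, rfl⟩
  refine ⟨(l.take m).prod, ⟨l.take m, by simp, fun x hx => hX x (List.mem_of_mem_take hx), rfl⟩,
    (l.drop m).prod, ⟨l.drop m, by simp; omega, fun x hx => hX x (List.mem_of_mem_drop hx), rfl⟩,
    List.prod_take_mul_prod_drop ..⟩

theorem wordBall_zero (X : Finset G) : wordBall X 0 = {1} := by
  refine Set.Subset.antisymm ?_ (by simpa using one_mem_wordBall X 0)
  rintro g ⟨l, hl, -, rfl⟩
  simp [List.length_eq_zero_iff.1 (Nat.le_zero.1 hl)]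

theorem wordBall_one_finite (X : Finset G) : (wordBall X 1).Finite := by
  refine ((X.finite_toSet.union X.finite_toSet.inv).insert 1).subset ?_
  rintro g ⟨l, hl, hX, rfl⟩
  match l, hl, hX with
  | [], _, _ => simp
  | [x], _, hX => right; simpa using hX

theorem wordBall_finite (X : Finset G) (n : ℕ) : (wordBall X n).Finite := by
  induction n with
  | zero => simp [wordBall_zero]
  | succ n ih => exact (ih.mul (wordBall_one_finite X)).subset (wordBall_add_subset X n 1)

theorem growthFn_add_le (X : Finset G) (m n : ℕ) :
    growthFn X (m + n) ≤ growthFn X m * growthFn X n :=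
  (Nat.card_mono ((wordBall_finite X m).mul (wordBall_finite X n))
    (wordBall_add_subset X m n)).trans Set.natCard_mul_le

theorem growthFn_mul_le_pow (X : Finset G) (k n : ℕ) :
    growthFn X (k * n) ≤ growthFn X n ^ k := by
  induction k with
  | zero => simp [growthFn, wordBall_zero]
  | succ k ih =>
    rw [Nat.succ_mul, pow_succ]
    exact (growthFn_add_le X _ _).trans (Nat.mul_le_mul_right _ ih)

theorem exists_word_of_closure_eq_top {X : Finset G} (hX : Subgroup.closure (X : Set G) = ⊤)
    (g : G) : ∃ l : List G, (∀ x ∈ l, x ∈ X ∨ x⁻¹ ∈ X) ∧ l.prod = g := by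
  have hg : g ∈ (Subgroup.closure (X : Set G)).toSubmonoid := by simp [hX]
  rw [Subgroup.closure_toSubmonoid] at hg
  simpa using Submonoid.exists_list_of_mem_closure hg

/-- Every right coset of a subgroup of finite index has a representative of length less than
the index. -/
theorem exists_short_coset_rep {X : Finset G} (hX : Subgroup.closure (X : Set G) = ⊤)
    (R : Subgroup G) [R.FiniteIndex] (g : G) :
    ∃ t ∈ wordBall X (R.index - 1), g * t⁻¹ ∈ R := by
  classical
  have hex : ∃ n, ∃ l : List G, l.length = n ∧ (∀ x ∈ l, x ∈ X ∨ x⁻¹ ∈ X) ∧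
      g * l.prod⁻¹ ∈ R := by
    obtain ⟨l, hl, rfl⟩ := exists_word_of_closure_eq_top hX g
    exact ⟨_, l, rfl, hl, by simp⟩
  obtain ⟨l, hlen, hl, hgl⟩ := Nat.find_spec hex
  refine ⟨l.prod, ⟨l, ?_, hl, rfl⟩, hgl⟩
  by_contra hlong
  have : Fintype (G ⧸ R) := R.fintypeQuotientOfFiniteIndex
  have hcard : Fintype.card (G ⧸ R) < Fintype.card (Fin (R.index + 1)) := by
    rw [Fintype.card_fin, Subgroup.index_eq_card, Nat.card_eq_fintype_card]
    omega
  obtain ⟨i, j, hij, heq⟩ := Fintype.exists_ne_map_eq_of_card_lt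
    (fun i : Fin (R.index + 1) => (((l.take i).prod⁻¹ : G) : G ⧸ R)) hcard
  wlog hlt : i < j generalizing i j
  · exact this j i hij.symm heq.symm (lt_of_le_of_ne (not_lt.1 hlt) hij.symm)
  have hmem : (l.take j).prod * (l.take i).prod⁻¹ ∈ R := by
    simpa using QuotientGroup.eq.1 heq.symm
  refine Nat.find_min hex (m := (l.take i ++ l.drop j).length) ?_
    ⟨_, rfl, fun x hx => ?_, ?_⟩
  · rw [← hlen]
    have := j.2
    have : (i : ℕ) < j := hlt
    simp only [List.length_append, List.length_take, List.length_drop]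
    omega
  · rcases List.mem_append.1 hx with hx | hx
    exacts [hl x (List.mem_of_mem_take hx), hl x (List.mem_of_mem_drop hx)]
  · rw [← List.prod_take_mul_prod_drop l j] at hgl
    simpa only [List.prod_append, mul_inv_rev, mul_assoc, inv_mul_cancel_left] using R.mul_mem hgl hmem

/-- A subgroup of finite index `d` is generated by its elements of length at most `2 * d - 1`. -/
theorem closure_preimage_wordBall_eq_top {X : Finset G}
    (hX : Subgroup.closure (X : Set G) = ⊤) (R : Subgroup G) [R.FiniteIndex] :
    Subgroup.closure ((↑) ⁻¹' wordBall X (2 * R.index - 1) : Set R) = ⊤ := by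
  set Y : Set R := (↑) ⁻¹' wordBall X (2 * R.index - 1) with hY
  have hd : R.index ≠ 0 := Subgroup.FiniteIndex.index_ne_zero
  have key : ∀ l : List G, (∀ x ∈ l, x ∈ X ∨ x⁻¹ ∈ X) →
      ∃ y ∈ Subgroup.closure Y, ∃ t ∈ wordBall X (R.index - 1), l.prod = (y : G) * t := by
    intro l
    induction l using List.reverseRecOn with
    | nil => exact fun _ => ⟨1, one_mem _, 1, one_mem_wordBall X _, by simp⟩
    | append_singleton l x ih =>
      intro hl
      obtain ⟨y, hy, t, ht, hyt⟩ := ih fun z hz => hl z (by simp [hz])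
      obtain ⟨s, hs, hsR⟩ := exists_short_coset_rep hX R (t * x)
      refine ⟨y * ⟨t * x * s⁻¹, hsR⟩, mul_mem hy (Subgroup.subset_closure ?_), s, hs, ?_⟩
      · exact wordBall_mono X (by omega) (mul_mem_wordBall (mul_mem_wordBall ht
          (letter_mem_wordBall_one (hl x (by simp)))) (inv_mem_wordBall hs))
      · simp [hyt, mul_assoc]
  refine (Subgroup.eq_top_iff' _).2 fun r => ?_
  obtain ⟨l, hl, hlr⟩ := exists_word_of_closure_eq_top hX (r : G)
  obtain ⟨y, hy, t, ht, hyt⟩ := key l hl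
  have hr : t = ((y⁻¹ * r : R) : G) := by simp [← hlr, hyt]
  have : y⁻¹ * r ∈ Y := by
    rw [hY, Set.mem_preimage, ← hr]
    exact wordBall_mono X (by omega) ht
  simpa using mul_mem hy (Subgroup.subset_closure this)

theorem coe_mem_wordBall_mul {X : Finset G} {R : Subgroup G} {Y : Finset R} {k n : ℕ}
    (hY : ∀ y ∈ Y, (y : G) ∈ wordBall X k) {r : R} (hr : r ∈ wordBall Y n) :
    (r : G) ∈ wordBall X (k * n) := by
  obtain ⟨l, hl, hlY, rfl⟩ := hr
  refine wordBall_mono X (Nat.mul_le_mul_left k hl) ?_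
  clear hl
  induction l with
  | nil => exact one_mem_wordBall X _
  | cons x l ih =>
    rw [List.prod_cons, List.length_cons, Nat.mul_succ, add_comm]
    refine mul_mem_wordBall ?_ (ih fun z hz => hlY z (by simp [hz]))
    rcases hlY x (by simp) with h | h
    · exact hY x h
    · simpa using inv_mem_wordBall (hY _ h)

theorem growthFn_le_growthFn_mul {X : Finset G} {R : Subgroup G} {Y : Finset R} {k : ℕ}
    (hY : ∀ y ∈ Y, (y : G) ∈ wordBall X k) (n : ℕ) : growthFn Y n ≤ growthFn X (k * n) := by
  have : Finite (wordBall X (k * n)) := wordBall_finite X _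
  exact Nat.card_le_card_of_injective
    (fun r : wordBall Y n => (⟨(r : R), coe_mem_wordBall_mul hY r.2⟩ : wordBall X (k * n)))
    fun a b h => Subtype.ext (Subtype.ext (Subtype.mk.inj h))

theorem growthRateX_nonneg (X : Finset G) : 0 ≤ growthRateX X :=
  Real.iInf_nonneg fun _ => by positivity

theorem minGrowthRate_nonneg (G : Type*) [Group G] : 0 ≤ minGrowthRate G := by
  refine Real.sInf_nonneg ?_
  rintro _ ⟨X, -, rfl⟩
  exact growthRateX_nonneg X

theorem minGrowthRate_le_growthRateX {X : Finset G}
    (hX : Subgroup.closure (X : Set G) = ⊤) : minGrowthRate G ≤ growthRateX X := by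
  refine csInf_le ⟨0, ?_⟩ ⟨X, hX, rfl⟩
  rintro _ ⟨Z, -, rfl⟩
  exact growthRateX_nonneg Z

theorem growthRateX_le (X : Finset G) (n : ℕ) :
    growthRateX X ≤ (growthFn X (n + 1) : ℝ) ^ ((1 : ℝ) / (n + 1)) :=
  ciInf_le ⟨0, by rintro _ ⟨m, rfl⟩; positivity⟩ n

theorem le_sInf_pow {S : Set ℝ} (hS : S.Nonempty) (hS0 : ∀ a ∈ S, 0 ≤ a) {c : ℝ} (hc : 0 ≤ c)
    {k : ℕ} (hk : k ≠ 0) (h : ∀ a ∈ S, c ≤ a ^ k) : c ≤ sInf S ^ k := by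
  have hroot : c ^ ((k : ℝ)⁻¹) ≤ sInf S := le_csInf hS fun a ha => by
    rw [← Real.pow_rpow_inv_natCast (hS0 a ha) hk]
    exact Real.rpow_le_rpow hc (h a ha) (by positivity)
  calc c = (c ^ ((k : ℝ)⁻¹)) ^ k := (Real.rpow_inv_natCast_pow hc hk).symm
    _ ≤ sInf S ^ k := pow_le_pow_left₀ (by positivity) hroot k

theorem growthRateX_le_pow {X : Finset G} {R : Subgroup G} {Y : Finset R} {k : ℕ} (hk : k ≠ 0)
    (hY : ∀ y ∈ Y, (y : G) ∈ wordBall X k) : growthRateX Y ≤ growthRateX X ^ k := by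
  refine le_sInf_pow (Set.range_nonempty _) ?_ (growthRateX_nonneg Y) hk ?_
  · rintro _ ⟨n, rfl⟩
    positivity
  · rintro _ ⟨n, rfl⟩
    refine (growthRateX_le Y n).trans ?_
    rw [Real.rpow_pow_comm (by positivity)]
    refine Real.rpow_le_rpow (by positivity) ?_ (by positivity)
    exact_mod_cast (growthFn_le_growthFn_mul hY _).trans (growthFn_mul_le_pow X k _)

end GrowthLemmas

/-- **Lemma 3.2(2) (Osin).** If `G` is a finitely generated group and `R ≤ G` has finite
index, then `R` is finitely generated and `ω(R) ≤ ω(G)^(2[G:R]-1)`. -/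
theorem minGrowthRate_finite_index_subgroup
    {G : Type*} [Group G] (hfg : Group.FG G) (R : Subgroup G) (hR : R.FiniteIndex) :
    R.FG ∧ minGrowthRate R ≤ minGrowthRate G ^ (2 * R.index - 1) := by
  obtain ⟨X₀, hX₀⟩ := Group.fg_def.1 hfg
  have hk : 2 * R.index - 1 ≠ 0 := by
    have : R.index ≠ 0 := hR.index_ne_zero
    omega
  have hgen : ∀ X : Finset G, Subgroup.closure (X : Set G) = ⊤ →
      ∃ Y : Finset R, Subgroup.closure (Y : Set R) = ⊤ ∧
        ∀ y ∈ Y, (y : G) ∈ wordBall X (2 * R.index - 1) := fun X hX => by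
    have hfin := (wordBall_finite X (2 * R.index - 1)).preimage
      (Subtype.val_injective (p := (· ∈ R))).injOn
    exact ⟨hfin.toFinset, by simpa using closure_preimage_wordBall_eq_top hX R, by simp⟩
  constructor
  · obtain ⟨Y, hY, -⟩ := hgen X₀ hX₀
    exact (Group.fg_iff_subgroup_fg R).1 (Group.fg_def.2 ⟨Y, hY⟩)
  · refine le_sInf_pow (S := {r : ℝ | ∃ X : Finset G, Subgroup.closure (X : Set G) = ⊤ ∧
      r = growthRateX X}) ⟨_, X₀, hX₀, rfl⟩ ?_ (minGrowthRate_nonneg R) hk ?_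
    · rintro _ ⟨X, -, rfl⟩
      exact growthRateX_nonneg X
    · rintro _ ⟨X, hX, rfl⟩
      obtain ⟨Y, hY, hYX⟩ := hgen X hX
      exact (minGrowthRate_le_growthRateX hY).trans (growthRateX_le_pow hk hYX)
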